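/- (Feasibility of the natural policy gradient step.) Suppose K ∈ 𝕂 and let K' = K − 2ηL^K. If the step size satisfies 0 < η ≤ 1/(2·max_i ‖R_i + B_iᵀ E_i(P^K) B_i‖), then K' ∈ 𝕂, i.e., K' is mean-square stabilizing. -/

import Mathlib

open Matrix Filter
open scoped Kronecker Topology

namespace MJLS

noncomputable section

attribute [local instance] Classical.propDecidable

/-- Closed-loop matrices `Γ i = A i - B i * K i`. -/
def Gam {d k N : ℕ} (A : Fin N → Matrix (Fin d) (Fin d) ℝ)
    (B : Fin N → Matrix (Fin d) (Fin k) ℝ)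
    (K : Fin N → Matrix (Fin k) (Fin d) ℝ) : Fin N → Matrix (Fin d) (Fin d) ℝ :=
  fun i => A i - B i * K i

/-- The operator `E_i(V) = ∑ j, p i j • V j`. -/
def opE {d N : ℕ} (Pr : Matrix (Fin N) (Fin N) ℝ)
    (V : Fin N → Matrix (Fin d) (Fin d) ℝ) : Fin N → Matrix (Fin d) (Fin d) ℝ :=
  fun i => ∑ j, Pr i j • V j

/-- The matrix `𝒜 = diag(Γᵀ ⊗ Γᵀ) (P ⊗ I)`. -/
def calA {d N : ℕ} (Pr : Matrix (Fin N) (Fin N) ℝ)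
    (Γ : Fin N → Matrix (Fin d) (Fin d) ℝ) :
    Matrix (Fin N × Fin d × Fin d) (Fin N × Fin d × Fin d) ℝ :=
  (Matrix.reindex (Equiv.prodComm (Fin d × Fin d) (Fin N))
      (Equiv.prodComm (Fin d × Fin d) (Fin N))
      (Matrix.blockDiagonal fun i => (Γ i)ᵀ ⊗ₖ (Γ i)ᵀ)) *
    (Pr ⊗ₖ (1 : Matrix (Fin d × Fin d) (Fin d × Fin d) ℝ))

/-- `K` is mean-square stabilizing: the spectral radius of `𝒜` is less than `1`. -/
def MSS {d k N : ℕ} (Pr : Matrix (Fin N) (Fin N) ℝ)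
    (A : Fin N → Matrix (Fin d) (Fin d) ℝ) (B : Fin N → Matrix (Fin d) (Fin k) ℝ)
    (K : Fin N → Matrix (Fin k) (Fin d) ℝ) : Prop :=
  spectralRadius ℂ ((calA Pr (Gam A B K)).map (algebraMap ℝ ℂ)) < 1

/-- `P` solves the coupled Lyapunov equations for the policy `K`. -/
def IsLyap {d k N : ℕ} (Pr : Matrix (Fin N) (Fin N) ℝ)
    (A : Fin N → Matrix (Fin d) (Fin d) ℝ) (B : Fin N → Matrix (Fin d) (Fin k) ℝ)
    (Q : Fin N → Matrix (Fin d) (Fin d) ℝ) (R : Fin N → Matrix (Fin k) (Fin k) ℝ)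
    (K : Fin N → Matrix (Fin k) (Fin d) ℝ)
    (P : Fin N → Matrix (Fin d) (Fin d) ℝ) : Prop :=
  ∀ i, P i = Q i + (K i)ᵀ * R i * K i + (Gam A B K i)ᵀ * opE Pr P i * Gam A B K i

/-- `P^K`, the (for mean-square stabilizing `K`, unique) solution of the coupled
Lyapunov equations. -/
def PK {d k N : ℕ} (Pr : Matrix (Fin N) (Fin N) ℝ)
    (A : Fin N → Matrix (Fin d) (Fin d) ℝ) (B : Fin N → Matrix (Fin d) (Fin k) ℝ)
    (Q : Fin N → Matrix (Fin d) (Fin d) ℝ) (R : Fin N → Matrix (Fin k) (Fin k) ℝ)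
    (K : Fin N → Matrix (Fin k) (Fin d) ℝ) : Fin N → Matrix (Fin d) (Fin d) ℝ :=
  if h : ∃ P, IsLyap Pr A B Q R K P then h.choose else 0

/-- The LQR cost `C(K) = ∑ i, π i * tr(P^K_i Sg)`. -/
def cost {d k N : ℕ} (Pr : Matrix (Fin N) (Fin N) ℝ)
    (A : Fin N → Matrix (Fin d) (Fin d) ℝ) (B : Fin N → Matrix (Fin d) (Fin k) ℝ)
    (Q : Fin N → Matrix (Fin d) (Fin d) ℝ) (R : Fin N → Matrix (Fin k) (Fin k) ℝ)
    (piv : Fin N → ℝ) (Sg : Matrix (Fin d) (Fin d) ℝ)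
    (K : Fin N → Matrix (Fin k) (Fin d) ℝ) : ℝ :=
  ∑ i, piv i * (PK Pr A B Q R K i * Sg).trace

/-- The operator `T_j(V) = ∑ i, p i j • (Γ i * V i * Γ iᵀ)`. -/
def opT {d N : ℕ} (Pr : Matrix (Fin N) (Fin N) ℝ)
    (Γ : Fin N → Matrix (Fin d) (Fin d) ℝ)
    (V : Fin N → Matrix (Fin d) (Fin d) ℝ) : Fin N → Matrix (Fin d) (Fin d) ℝ :=
  fun j => ∑ i, Pr i j • (Γ i * V i * (Γ i)ᵀ)

/-- `𝐗^K = ∑_{t=0}^∞ T^t(X(0))` with `X_i(0) = π i • Sg`. -/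
def XK {d N : ℕ} (Pr : Matrix (Fin N) (Fin N) ℝ) (piv : Fin N → ℝ)
    (Sg : Matrix (Fin d) (Fin d) ℝ) (Γ : Fin N → Matrix (Fin d) (Fin d) ℝ) :
    Fin N → Matrix (Fin d) (Fin d) ℝ :=
  ∑' t : ℕ, (opT Pr Γ)^[t] (fun i => piv i • Sg)

/-- `L^K_i = (R i + B iᵀ E_i(P^K) B i) K i - B iᵀ E_i(P^K) A i`. -/
def LK {d k N : ℕ} (Pr : Matrix (Fin N) (Fin N) ℝ)
    (A : Fin N → Matrix (Fin d) (Fin d) ℝ) (B : Fin N → Matrix (Fin d) (Fin k) ℝ)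
    (Q : Fin N → Matrix (Fin d) (Fin d) ℝ) (R : Fin N → Matrix (Fin k) (Fin k) ℝ)
    (K : Fin N → Matrix (Fin k) (Fin d) ℝ) : Fin N → Matrix (Fin k) (Fin d) ℝ :=
  fun i => (R i + (B i)ᵀ * opE Pr (PK Pr A B Q R K) i * B i) * K i
    - (B i)ᵀ * opE Pr (PK Pr A B Q R K) i * A i

/-- The operator `L_i(V) = Γ iᵀ E_i(V) Γ i`. -/
def opL {d N : ℕ} (Pr : Matrix (Fin N) (Fin N) ℝ)
    (Γ : Fin N → Matrix (Fin d) (Fin d) ℝ)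
    (V : Fin N → Matrix (Fin d) (Fin d) ℝ) : Fin N → Matrix (Fin d) (Fin d) ℝ :=
  fun i => (Γ i)ᵀ * opE Pr V i * Γ i

/-- `(P^K)'[E] = ∑_{t=0}^∞ L^t(Eᵀ L^K + (L^K)ᵀ E)`. -/
def PKd {d k N : ℕ} (Pr : Matrix (Fin N) (Fin N) ℝ)
    (Γ : Fin N → Matrix (Fin d) (Fin d) ℝ)
    (Lk E : Fin N → Matrix (Fin k) (Fin d) ℝ) : Fin N → Matrix (Fin d) (Fin d) ℝ :=
  ∑' t : ℕ, (opL Pr Γ)^[t] (fun i => (E i)ᵀ * Lk i + (Lk i)ᵀ * E i)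

/-- `‖V‖₂² = ∑ i, tr(V iᵀ V i)`. -/
def norm2sq {a b N : ℕ} (V : Fin N → Matrix (Fin a) (Fin b) ℝ) : ℝ :=
  ∑ i, ((V i)ᵀ * V i).trace

/-- The inner product `⟨V, S⟩ = ∑ i, tr(V iᵀ S i)`. -/
def ip {a b N : ℕ} (V S : Fin N → Matrix (Fin a) (Fin b) ℝ) : ℝ :=
  ∑ i, ((V i)ᵀ * S i).trace

/-- The spectral norm (maximal singular value) of a matrix. -/
def specNorm {a b : ℕ} (M : Matrix (Fin a) (Fin b) ℝ) : ℝ :=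
  ⨆ x : {x : EuclideanSpace ℝ (Fin b) // ‖x‖ ≤ 1}, ‖Matrix.toEuclideanLin M x.1‖

/-- The minimal singular value of a square matrix. -/
def sigmaMin {a : ℕ} (M : Matrix (Fin a) (Fin a) ℝ) : ℝ :=
  ⨅ x : {x : EuclideanSpace ℝ (Fin a) // ‖x‖ = 1}, ‖Matrix.toEuclideanLin M x.1‖

/-- `‖V‖_max = max_i ‖V i‖` (spectral norms). -/
def maxNorm {a b N : ℕ} (V : Fin N → Matrix (Fin a) (Fin b) ℝ) : ℝ :=
  ⨆ i, specNorm (V i)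

/-- `Λ_min(V) = min_i σ_min(V i)`. -/
def lamMin {a N : ℕ} (V : Fin N → Matrix (Fin a) (Fin a) ℝ) : ℝ :=
  ⨅ i, sigmaMin (V i)

/-- `μ = (min_i π i) · σ_min(Sg)`. -/
def mu {d N : ℕ} (piv : Fin N → ℝ) (Sg : Matrix (Fin d) (Fin d) ℝ) : ℝ :=
  (⨅ i, piv i) * sigmaMin Sg

/-- `ξ(α) = (1/Λ_min(Q))·((1 + ‖B‖²_max)·α/μ + ‖R‖_max) − 1`. -/
def xi {d k N : ℕ} (B : Fin N → Matrix (Fin d) (Fin k) ℝ)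
    (R : Fin N → Matrix (Fin k) (Fin k) ℝ) (Q : Fin N → Matrix (Fin d) (Fin d) ℝ)
    (piv : Fin N → ℝ) (Sg : Matrix (Fin d) (Fin d) ℝ) (α : ℝ) : ℝ :=
  (1 / lamMin Q) * ((1 + maxNorm B ^ 2) * α / mu piv Sg + maxNorm R) - 1

/-- The smoothness constant
`L(α) = 2·(‖R‖_max + ‖B‖²_max·(1 + 2ξ(α)/‖B‖_max)·α/μ)·α/Λ_min(Q)`. -/
def Lsm {d k N : ℕ} (B : Fin N → Matrix (Fin d) (Fin k) ℝ)
    (R : Fin N → Matrix (Fin k) (Fin k) ℝ) (Q : Fin N → Matrix (Fin d) (Fin d) ℝ)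
    (piv : Fin N → ℝ) (Sg : Matrix (Fin d) (Fin d) ℝ) (α : ℝ) : ℝ :=
  2 * (maxNorm R + maxNorm B ^ 2 * (1 + 2 * xi B R Q piv Sg α / maxNorm B)
      * α / mu piv Sg) * α / lamMin Q

end

section GenericSpectral

attribute [local instance] Matrix.linftyOpNormedRing Matrix.linftyOpNormedAlgebra

theorem pow_tendsto_aux {n : Type*} [Fintype n] [DecidableEq n] (M : Matrix n n ℂ)
    (h : spectralRadius ℂ M < 1) (i j : n) :
    Tendsto (fun t : ℕ => (M ^ t) i j) atTop (𝓝 0) := by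
  have hg := spectrum.pow_nnnorm_pow_one_div_tendsto_nhds_spectralRadius M
  obtain ⟨s, hs1, hs2⟩ := ENNReal.lt_iff_exists_nnreal_btwn.1 h
  have hs3 : s < 1 := by exact_mod_cast hs2
  have hev := hg.eventually_lt_const hs1
  rw [tendsto_zero_iff_norm_tendsto_zero]
  have hpow : Tendsto (fun t : ℕ => (s : ℝ) ^ t) atTop (𝓝 0) :=
    tendsto_pow_atTop_nhds_zero_of_lt_one s.2 (by exact_mod_cast hs3)
  refine squeeze_zero' (Eventually.of_forall fun t => norm_nonneg _) ?_ hpow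
  filter_upwards [hev, eventually_gt_atTop 0] with t ht ht0
  have h1 : ((‖M ^ t‖₊ : ENNReal) ^ (1 / (t : ℝ))) ^ (t : ℝ) ≤ (s : ENNReal) ^ (t : ℝ) :=
    ENNReal.rpow_le_rpow ht.le (by positivity)
  rw [← ENNReal.rpow_mul, one_div, inv_mul_cancel₀ (by positivity), ENNReal.rpow_one,
    ENNReal.rpow_natCast] at h1
  have h2 : ‖M ^ t‖₊ ≤ s ^ t := by exact_mod_cast h1
  have h3 : ‖(M ^ t) i j‖₊ ≤ ‖M ^ t‖₊ := by
    rw [Matrix.linfty_opNNNorm_def]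
    refine le_trans ?_ (Finset.le_sup (f := fun i => ∑ j, ‖(M ^ t) i j‖₊) (Finset.mem_univ i))
    exact Finset.single_le_sum (f := fun j => ‖(M ^ t) i j‖₊) (fun _ _ => zero_le)
      (Finset.mem_univ j)
  exact_mod_cast h3.trans h2

theorem sr_lt_one_aux {n : Type*} [Fintype n] [DecidableEq n] [Nonempty n] (M : Matrix n n ℂ)
    (h : ∀ l : ℂ, 1 ≤ ‖l‖ → ∀ v : n → ℂ, M *ᵥ v = l • v → v = 0) :
    spectralRadius ℂ M < 1 := by
  have := spectrum.spectralRadius_lt_of_forall_lt M (r := 1) ?_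
  · simpa using this
  intro z hz
  by_contra hcon
  push Not at hcon
  have hz1 : 1 ≤ ‖z‖ := by exact_mod_cast hcon
  rw [← Matrix.spectrum_toLin', ← Module.End.hasEigenvalue_iff_mem_spectrum] at hz
  obtain ⟨v, hv⟩ := hz.exists_hasEigenvector
  refine hv.2 (h z hz1 v ?_)
  simpa using hv.apply_eq_smul

end GenericSpectral

theorem pow_mulVec_tendsto {n : Type*} [Fintype n] [DecidableEq n] (M : Matrix n n ℝ)
    (h : spectralRadius ℂ (M.map (algebraMap ℝ ℂ)) < 1) (v : n → ℝ) :
    Tendsto (fun t : ℕ => (M ^ t) *ᵥ v) atTop (𝓝 0) := by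
  have h1 := pow_tendsto_aux _ h
  have h2 : Tendsto (fun t : ℕ => M ^ t) atTop (𝓝 0) := by
    refine tendsto_pi_nhds.2 fun i => tendsto_pi_nhds.2 fun j => ?_
    have h4 := (Complex.continuous_re.tendsto _).comp (h1 i j)
    refine (h4.congr ?_)
    intro t
    have : (M.map (algebraMap ℝ ℂ)) ^ t = (M ^ t).map (algebraMap ℝ ℂ) := by
      have := map_pow (algebraMap ℝ ℂ).mapMatrix M t
      simpa using this.symm
    rw [Function.comp_apply, this]
    simp
  have h3 : Continuous fun A : Matrix n n ℝ => A *ᵥ v := by fun_prop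
  have := (h3.tendsto 0).comp h2
  simpa [Function.comp_def] using this

/-- Quadratic forms. -/
theorem quad_opE {d N : ℕ} (Pr : Matrix (Fin N) (Fin N) ℝ)
    (V : Fin N → Matrix (Fin d) (Fin d) ℝ) (i : Fin N) (x y : Fin d → ℝ) :
    x ⬝ᵥ (opE Pr V i *ᵥ y) = ∑ j, Pr i j * (x ⬝ᵥ (V j *ᵥ y)) := by
  simp [opE, Matrix.sum_mulVec, dotProduct_sum, Matrix.smul_mulVec]

theorem quad_opL {d N : ℕ} (Pr : Matrix (Fin N) (Fin N) ℝ) (Γ : Fin N → Matrix (Fin d) (Fin d) ℝ)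
    (V : Fin N → Matrix (Fin d) (Fin d) ℝ) (i : Fin N) (x y : Fin d → ℝ) :
    x ⬝ᵥ (opL Pr Γ V i *ᵥ y) = ∑ j, Pr i j * ((Γ i *ᵥ x) ⬝ᵥ (V j *ᵥ (Γ i *ᵥ y))) := by
  rw [← quad_opE, opL, ← Matrix.mulVec_mulVec, ← Matrix.mulVec_mulVec,
    Matrix.dotProduct_mulVec x, Matrix.vecMul_transpose]

theorem calA_apply {d N : ℕ} (Pr : Matrix (Fin N) (Fin N) ℝ)
    (Γ : Fin N → Matrix (Fin d) (Fin d) ℝ) (i j : Fin N) (a b c e : Fin d) :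
    calA Pr Γ (i, a, b) (j, c, e) = Γ i c a * Γ i e b * Pr i j := by
  simp only [calA, Matrix.mul_apply, Fintype.sum_prod_type, Matrix.reindex_apply,
    Matrix.submatrix_apply, Matrix.kroneckerMap_apply, Equiv.prodComm_symm, Equiv.prodComm_apply,
    Prod.swap_prod_mk, Matrix.blockDiagonal_apply, Matrix.one_apply, Matrix.transpose_apply]
  rw [Finset.sum_eq_single i, Finset.sum_eq_single c, Finset.sum_eq_single e]
  · simp
  · intro x _ hx
    simp [hx]
  · simp
  · intro x _ hx
    simp [hx]
  · simp
  · intro x _ hx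
    simp [hx.symm]
  · simp

/-- Vectorization. -/
def vecT {d N : ℕ} (V : Fin N → Matrix (Fin d) (Fin d) ℝ) : Fin N × Fin d × Fin d → ℝ :=
  fun p => V p.1 p.2.1 p.2.2

theorem calA_mulVec {d N : ℕ} (Pr : Matrix (Fin N) (Fin N) ℝ)
    (Γ : Fin N → Matrix (Fin d) (Fin d) ℝ) (V : Fin N → Matrix (Fin d) (Fin d) ℝ) :
    calA Pr Γ *ᵥ vecT V = vecT (opL Pr Γ V) := by
  ext ⟨i, a, b⟩
  simp only [Matrix.mulVec, dotProduct, vecT, Fintype.sum_prod_type, calA_apply, opL, opE,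
    Matrix.mul_apply, Matrix.sum_apply, Matrix.smul_apply, Matrix.transpose_apply, smul_eq_mul,
    Finset.mul_sum, Finset.sum_mul]
  rw [Finset.sum_comm' (t' := Finset.univ) (s' := fun _ => Finset.univ) (by simp)]
  have h1 : ∀ c : Fin d, (∑ j : Fin N, ∑ e : Fin d, Γ i c a * Γ i e b * Pr i j * V j c e)
      = ∑ e : Fin d, ∑ j : Fin N, Γ i c a * Γ i e b * Pr i j * V j c e :=
    fun c => Finset.sum_comm
  simp only [h1]
  rw [Finset.sum_comm]
  refine Finset.sum_congr rfl fun e _ => ?_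
  rw [Finset.sum_comm]
  refine Finset.sum_congr rfl fun c _ => Finset.sum_congr rfl fun j _ => by ring

theorem opL_iter_tendsto {d N : ℕ} (Pr : Matrix (Fin N) (Fin N) ℝ)
    (Γ : Fin N → Matrix (Fin d) (Fin d) ℝ)
    (h : ∀ v, Tendsto (fun t : ℕ => (calA Pr Γ ^ t) *ᵥ v) atTop (𝓝 0))
    (V : Fin N → Matrix (Fin d) (Fin d) ℝ) (i : Fin N) :
    Tendsto (fun t : ℕ => (opL Pr Γ)^[t] V i) atTop (𝓝 0) := by
  have h1 : ∀ t : ℕ, (calA Pr Γ ^ t) *ᵥ vecT V = vecT ((opL Pr Γ)^[t] V) := by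
    intro t
    induction t with
    | zero => simp
    | succ t ih =>
      rw [pow_succ', ← Matrix.mulVec_mulVec, ih, calA_mulVec, Function.iterate_succ_apply']
  have h2 := h (vecT V)
  simp only [h1] at h2
  rw [tendsto_pi_nhds] at h2
  refine tendsto_pi_nhds.2 fun a => tendsto_pi_nhds.2 fun b => ?_
  exact h2 (i, a, b)

theorem lyap_exists {d N : ℕ} (Pr : Matrix (Fin N) (Fin N) ℝ)
    (Γ : Fin N → Matrix (Fin d) (Fin d) ℝ)
    (h : ∀ v, Tendsto (fun t : ℕ => (calA Pr Γ ^ t) *ᵥ v) atTop (𝓝 0))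
    (C : Fin N → Matrix (Fin d) (Fin d) ℝ) :
    ∃ P : Fin N → Matrix (Fin d) (Fin d) ℝ, ∀ i, P i = C i + opL Pr Γ P i := by
  have hinj : Function.Injective (1 - calA Pr Γ).mulVec := by
    rw [← Matrix.coe_mulVecLin, ← LinearMap.ker_eq_bot, LinearMap.ker_eq_bot']
    intro v hv
    have hv' : calA Pr Γ *ᵥ v = v := by
      simp only [Matrix.mulVecLin_apply, Matrix.sub_mulVec, Matrix.one_mulVec] at hv
      exact (sub_eq_zero.1 hv).symm
    have h1 : ∀ t : ℕ, (calA Pr Γ ^ t) *ᵥ v = v := by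
      intro t
      induction t with
      | zero => simp
      | succ t ih => rw [pow_succ', ← Matrix.mulVec_mulVec, ih, hv']
    have h2 := h v
    simp only [h1] at h2
    exact tendsto_nhds_unique tendsto_const_nhds h2
  have hsurj : Function.Surjective (1 - calA Pr Γ).mulVec :=
    Matrix.mulVec_surjective_iff_isUnit.2 (Matrix.mulVec_injective_iff_isUnit.1 hinj)
  obtain ⟨v, hv⟩ := hsurj (vecT C)
  refine ⟨fun i => Matrix.of fun a b => v (i, a, b), fun i => ?_⟩
  have h3 : v = vecT (fun i => Matrix.of fun a b => v (i, a, b)) := by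
    ext ⟨i, a, b⟩
    rfl
  rw [Matrix.sub_mulVec, Matrix.one_mulVec, h3, calA_mulVec] at hv
  ext a b
  have h4 := congrFun hv (i, a, b)
  simp only [vecT, Pi.sub_apply, Matrix.of_apply] at h4
  simp only [Matrix.add_apply, Matrix.of_apply]
  linarith

theorem lyap_nonneg {d N : ℕ} (Pr : Matrix (Fin N) (Fin N) ℝ) (hPr : ∀ i j, 0 ≤ Pr i j)
    (Γ : Fin N → Matrix (Fin d) (Fin d) ℝ)
    (h : ∀ v, Tendsto (fun t : ℕ => (calA Pr Γ ^ t) *ᵥ v) atTop (𝓝 0))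
    (P : Fin N → Matrix (Fin d) (Fin d) ℝ)
    (hP : ∀ i x, x ⬝ᵥ (opL Pr Γ P i *ᵥ x) ≤ x ⬝ᵥ (P i *ᵥ x)) (i : Fin N) (x : Fin d → ℝ) :
    0 ≤ x ⬝ᵥ (P i *ᵥ x) := by
  have h1 : ∀ t : ℕ, ∀ i x, x ⬝ᵥ ((opL Pr Γ)^[t] P i *ᵥ x) ≤ x ⬝ᵥ (P i *ᵥ x) := by
    intro t
    induction t with
    | zero => simp
    | succ t ih =>
      intro i x
      rw [Function.iterate_succ_apply']
      refine le_trans ?_ (hP i x)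
      rw [quad_opL, quad_opL]
      exact Finset.sum_le_sum fun j _ => mul_le_mul_of_nonneg_left (ih _ _) (hPr i j)
  have h2 := opL_iter_tendsto Pr Γ h P i
  have h3 : Continuous fun A : Matrix (Fin d) (Fin d) ℝ => x ⬝ᵥ (A *ᵥ x) := by fun_prop
  have h4 := (h3.tendsto 0).comp h2
  have h5 := le_of_tendsto' h4 (fun t => h1 t i x)
  simpa using h5

theorem lyap_symm {d N : ℕ} (Pr : Matrix (Fin N) (Fin N) ℝ)
    (Γ : Fin N → Matrix (Fin d) (Fin d) ℝ)
    (h : ∀ v, Tendsto (fun t : ℕ => (calA Pr Γ ^ t) *ᵥ v) atTop (𝓝 0))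
    (C P : Fin N → Matrix (Fin d) (Fin d) ℝ) (hC : ∀ i, (C i)ᵀ = C i)
    (hP : ∀ i, P i = C i + opL Pr Γ P i) (i : Fin N) : (P i)ᵀ = P i := by
  have hD : opL Pr Γ (fun i => (P i)ᵀ - P i) = (fun i => (P i)ᵀ - P i) := by
    funext i
    have hT : (P i)ᵀ = C i + opL Pr Γ (fun i => (P i)ᵀ) i := by
      conv_lhs => rw [hP i]
      rw [Matrix.transpose_add, hC]
      simp [opL, opE, Matrix.transpose_mul, Matrix.transpose_sum, Matrix.mul_assoc]
    have hsub : opL Pr Γ (fun i => (P i)ᵀ - P i) i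
        = opL Pr Γ (fun i => (P i)ᵀ) i - opL Pr Γ P i := by
      simp [opL, opE, smul_sub, Finset.sum_sub_distrib, Matrix.mul_sub, Matrix.sub_mul]
    have h0 := hP i
    rw [hsub]
    generalize opL Pr Γ P i = X at *
    generalize opL Pr Γ (fun i => (P i)ᵀ) i = Y at *
    rw [hT, h0]
    abel
  have h2 := opL_iter_tendsto Pr Γ h (fun i => (P i)ᵀ - P i) i
  have h3 : ∀ t : ℕ, (opL Pr Γ)^[t] (fun i => (P i)ᵀ - P i) = (fun i => (P i)ᵀ - P i) :=
    fun t => Function.iterate_fixed hD t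
  simp only [h3] at h2
  exact sub_eq_zero.1 (tendsto_nhds_unique tendsto_const_nhds h2)

/-- Complex bilinear form at real vectors. -/
noncomputable def bil {d N : ℕ} (v : Fin N × Fin d × Fin d → ℂ) (i : Fin N) (x y : Fin d → ℝ) : ℂ :=
  ∑ a, ∑ b, ((x a : ℂ) * (y b : ℂ)) * v (i, a, b)

theorem bil_step {d N : ℕ} (Pr : Matrix (Fin N) (Fin N) ℝ)
    (Γ : Fin N → Matrix (Fin d) (Fin d) ℝ) (v : Fin N × Fin d × Fin d → ℂ) (l : ℂ)
    (hv : (calA Pr Γ).map (algebraMap ℝ ℂ) *ᵥ v = l • v) (i : Fin N) (x y : Fin d → ℝ) :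
    l * bil v i x y = ∑ j, (Pr i j : ℂ) * bil v j (Γ i *ᵥ x) (Γ i *ᵥ y) := by
  have h1 : ∀ a b, l * v (i, a, b)
      = ∑ j, ∑ c, ∑ e, ((Γ i c a : ℂ) * (Γ i e b : ℂ) * (Pr i j : ℂ)) * v (j, c, e) := by
    intro a b
    have h := congrFun hv (i, a, b)
    simp only [Matrix.mulVec, dotProduct, Fintype.sum_prod_type, Matrix.map_apply, calA_apply,
      Pi.smul_apply, smul_eq_mul] at h
    rw [← h]
    simp
  have h2 : l * bil v i x y = ∑ a, ∑ b, ∑ j, ∑ c, ∑ e,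
      (Pr i j : ℂ) * ((Γ i c a * x a) * (Γ i e b * y b) * v (j, c, e)) := by
    simp only [bil, Finset.mul_sum]
    refine Finset.sum_congr rfl fun a _ => Finset.sum_congr rfl fun b _ => ?_
    rw [mul_left_comm, h1]
    simp only [Finset.mul_sum]
    refine Finset.sum_congr rfl fun j _ => Finset.sum_congr rfl fun c _ =>
      Finset.sum_congr rfl fun e _ => by ring
  have h3 : ∀ j, (Pr i j : ℂ) * bil v j (Γ i *ᵥ x) (Γ i *ᵥ y) = ∑ c, ∑ e, ∑ a, ∑ b,
      (Pr i j : ℂ) * ((Γ i c a * x a) * (Γ i e b * y b) * v (j, c, e)) := by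
    intro j
    simp only [bil, Matrix.mulVec, dotProduct, Complex.ofReal_sum, Complex.ofReal_mul]
    rw [Finset.mul_sum]
    refine Finset.sum_congr rfl fun c _ => ?_
    rw [Finset.mul_sum]
    refine Finset.sum_congr rfl fun e _ => ?_
    rw [Finset.sum_mul_sum, Finset.sum_mul, Finset.mul_sum]
    refine Finset.sum_congr rfl fun a _ => ?_
    rw [Finset.sum_mul, Finset.mul_sum]
  rw [h2]
  simp only [h3]
  have e1 : ∀ F : Fin d → Fin d → Fin N → Fin d → Fin d → ℂ,
      ∑ a, ∑ b, ∑ j, ∑ c, ∑ e, F a b j c e = ∑ j, ∑ c, ∑ e, ∑ a, ∑ b, F a b j c e := by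
    intro F
    have g1 : ∀ a, ∑ b, ∑ j, ∑ c, ∑ e, F a b j c e = ∑ j, ∑ c, ∑ e, ∑ b, F a b j c e := by
      intro a
      rw [Finset.sum_comm]
      refine Finset.sum_congr rfl fun j _ => ?_
      rw [Finset.sum_comm]
      refine Finset.sum_congr rfl fun c _ => ?_
      rw [Finset.sum_comm]
    simp only [g1]
    rw [Finset.sum_comm]
    refine Finset.sum_congr rfl fun j _ => ?_
    rw [Finset.sum_comm]
    refine Finset.sum_congr rfl fun c _ => ?_
    rw [Finset.sum_comm]
  exact e1 fun a b j c e => (Pr i j : ℂ) * ((Γ i c a * x a) * (Γ i e b * y b) * v (j, c, e))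

theorem bil_bound {d N : ℕ} (v : Fin N × Fin d × Fin d → ℂ) :
    ∃ m : ℝ, 0 ≤ m ∧ ∀ i x y, ‖bil v i x y‖ ≤ m * (x ⬝ᵥ x + y ⬝ᵥ y) := by
  refine ⟨(∑ p, ‖v p‖) * d, by positivity, fun i x y => ?_⟩
  have hm : ∀ p, ‖v p‖ ≤ ∑ p, ‖v p‖ := fun p =>
    Finset.single_le_sum (f := fun p => ‖v p‖) (fun _ _ => norm_nonneg _) (Finset.mem_univ p)
  set m := ∑ p, ‖v p‖ with hmdef
  have hm0 : 0 ≤ m := by positivity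
  calc ‖bil v i x y‖ ≤ ∑ a, ∑ b, (x a ^ 2 + y b ^ 2) * m := by
        refine (norm_sum_le _ _).trans (Finset.sum_le_sum fun a _ => ?_)
        refine (norm_sum_le _ _).trans (Finset.sum_le_sum fun b _ => ?_)
        rw [norm_mul, norm_mul, Complex.norm_real, Complex.norm_real, Real.norm_eq_abs,
          Real.norm_eq_abs]
        refine mul_le_mul ?_ (hm _) (norm_nonneg _) (by positivity)
        nlinarith [sq_nonneg (|x a| - |y b|), sq_abs (x a), sq_abs (y b), sq_nonneg (x a),
          sq_nonneg (y b)]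
    _ = m * d * (x ⬝ᵥ x + y ⬝ᵥ y) := by
        simp only [← Finset.sum_mul, Finset.sum_add_distrib, Finset.sum_const, Finset.card_univ,
          Fintype.card_fin, nsmul_eq_mul, dotProduct, pow_two]
        simp only [mul_assoc, ← Finset.mul_sum]
        ring

theorem stab {d N : ℕ} (Pr : Matrix (Fin N) (Fin N) ℝ) (hPr : ∀ i j, 0 ≤ Pr i j)
    (Γ : Fin N → Matrix (Fin d) (Fin d) ℝ) (q : Fin N → (Fin d → ℝ) → ℝ) (ρ ε : ℝ)
    (hρ0 : 0 ≤ ρ) (hρ1 : ρ < 1) (hε : 0 < ε)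
    (hq : ∀ i x, ∑ j, Pr i j * q j (Γ i *ᵥ x) ≤ ρ * q i x)
    (hqε : ∀ i x, ε * (x ⬝ᵥ x) ≤ q i x) (l : ℂ) (hl : 1 ≤ ‖l‖)
    (v : Fin N × Fin d × Fin d → ℂ)
    (hv : (calA Pr Γ).map (algebraMap ℝ ℂ) *ᵥ v = l • v) : v = 0 := by
  obtain ⟨m, hm0, hm⟩ := bil_bound v
  have hb : ∀ t : ℕ, ∀ i x y, ‖bil v i x y‖ ≤ ρ ^ t * (m / ε * (q i x + q i y)) := by
    intro t
    induction t with
    | zero =>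
      intro i x y
      rw [pow_zero, one_mul]
      refine (hm i x y).trans ?_
      rw [div_mul_eq_mul_div, le_div_iff₀ hε, mul_assoc]
      refine mul_le_mul_of_nonneg_left ?_ hm0
      linarith [hqε i x, hqε i y]
    | succ t ih =>
      intro i x y
      have hpt : 0 ≤ ρ ^ t * (m / ε) := by positivity
      calc ‖bil v i x y‖ ≤ ‖l‖ * ‖bil v i x y‖ := le_mul_of_one_le_left (norm_nonneg _) hl
        _ = ‖∑ j, (Pr i j : ℂ) * bil v j (Γ i *ᵥ x) (Γ i *ᵥ y)‖ := by
            rw [← norm_mul, bil_step Pr Γ v l hv]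
        _ ≤ ∑ j, Pr i j * (ρ ^ t * (m / ε * (q j (Γ i *ᵥ x) + q j (Γ i *ᵥ y)))) := by
            refine (norm_sum_le _ _).trans (Finset.sum_le_sum fun j _ => ?_)
            rw [norm_mul, Complex.norm_real, Real.norm_eq_abs, abs_of_nonneg (hPr i j)]
            exact mul_le_mul_of_nonneg_left (ih _ _ _) (hPr i j)
        _ = (ρ ^ t * (m / ε)) * (∑ j, Pr i j * q j (Γ i *ᵥ x)
              + ∑ j, Pr i j * q j (Γ i *ᵥ y)) := by
            rw [← Finset.sum_add_distrib, Finset.mul_sum]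
            exact Finset.sum_congr rfl fun j _ => by ring
        _ ≤ (ρ ^ t * (m / ε)) * (ρ * q i x + ρ * q i y) :=
            mul_le_mul_of_nonneg_left (add_le_add (hq i x) (hq i y)) hpt
        _ = _ := by ring
  ext ⟨i, a, b⟩
  have h0 : bil v i (Pi.single a 1) (Pi.single b 1) = v (i, a, b) := by
    unfold bil
    rw [Finset.sum_eq_single a, Finset.sum_eq_single b]
    · simp
    · intro c _ hc
      simp [hc]
    · simp
    · intro c _ hc
      simp [hc]
    · simp
  have h1 := fun t => hb t i (Pi.single a 1) (Pi.single b 1)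
  rw [h0] at h1
  have h2 : Tendsto (fun t : ℕ => ρ ^ t *
      (m / ε * (q i (Pi.single a 1) + q i (Pi.single b 1)))) atTop (𝓝 (0 *
      (m / ε * (q i (Pi.single a 1) + q i (Pi.single b 1))))) :=
    (tendsto_pow_atTop_nhds_zero_of_lt_one hρ0 hρ1).mul_const _
  have h3 := ge_of_tendsto' h2 h1
  rw [zero_mul] at h3
  simpa using h3

theorem posdef_bound {d : ℕ} (hd : 0 < d) (M S : Matrix (Fin d) (Fin d) ℝ) (hM : M.PosDef) :
    ∃ ε : ℝ, 0 < ε ∧ ∀ x : Fin d → ℝ, ε * (x ⬝ᵥ (S *ᵥ x)) ≤ x ⬝ᵥ (M *ᵥ x) := by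
  have : Nonempty (Fin d) := ⟨⟨0, hd⟩⟩
  have hc : ∀ T : Matrix (Fin d) (Fin d) ℝ, Continuous fun x : Fin d → ℝ => x ⬝ᵥ (T *ᵥ x) := by
    intro T
    fun_prop
  have hK : IsCompact (Metric.sphere (0 : Fin d → ℝ) 1) := isCompact_sphere _ _
  have hne : (Metric.sphere (0 : Fin d → ℝ) 1).Nonempty :=
    NormedSpace.sphere_nonempty.2 zero_le_one
  obtain ⟨u, hu, humin⟩ := hK.exists_isMinOn hne (hc M).continuousOn
  obtain ⟨w, hw, hwmax⟩ := hK.exists_isMaxOn hne ((hc S).abs).continuousOn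
  have hu0 : u ≠ 0 := by
    rintro rfl
    simp at hu
  have hm : 0 < u ⬝ᵥ (M *ᵥ u) := by
    simpa using hM.dotProduct_mulVec_pos hu0
  set m := u ⬝ᵥ (M *ᵥ u)
  set C := |w ⬝ᵥ (S *ᵥ w)|
  have hC : 0 ≤ C := abs_nonneg _
  refine ⟨m / (C + 1), by positivity, fun x => ?_⟩
  by_cases hx : x = 0
  · simp [hx]
  have hxn : 0 < ‖x‖ := norm_pos_iff.2 hx
  set z := ‖x‖⁻¹ • x with hz
  have hzs : z ∈ Metric.sphere (0 : Fin d → ℝ) 1 := by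
    simp [hz, norm_smul, hxn.ne']
  have hxz : x = ‖x‖ • z := by
    rw [hz, smul_smul, mul_inv_cancel₀ hxn.ne', one_smul]
  have hquad : ∀ T : Matrix (Fin d) (Fin d) ℝ,
      x ⬝ᵥ (T *ᵥ x) = ‖x‖ ^ 2 * (z ⬝ᵥ (T *ᵥ z)) := by
    intro T
    conv_lhs => rw [hxz]
    rw [Matrix.mulVec_smul, smul_dotProduct, dotProduct_smul, smul_eq_mul, smul_eq_mul]
    ring
  have h1 : m ≤ z ⬝ᵥ (M *ᵥ z) := humin hzs
  have h2 : |z ⬝ᵥ (S *ᵥ z)| ≤ C := hwmax hzs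
  have h3 : m / (C + 1) * (z ⬝ᵥ (S *ᵥ z)) ≤ z ⬝ᵥ (M *ᵥ z) := by
    refine le_trans ?_ h1
    rw [div_mul_eq_mul_div, div_le_iff₀ (by positivity)]
    exact mul_le_mul_of_nonneg_left (by linarith [le_abs_self (z ⬝ᵥ (S *ᵥ z))]) hm.le
  rw [hquad, hquad]
  nlinarith [mul_le_mul_of_nonneg_left h3 (sq_nonneg ‖x‖)]

theorem specNorm_quad {k : ℕ} (H : Matrix (Fin k) (Fin k) ℝ) (y : Fin k → ℝ) :
    y ⬝ᵥ (H *ᵥ y) ≤ specNorm H * (y ⬝ᵥ y) := by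
  set T := Matrix.toEuclideanLin H with hT
  have hbdd : BddAbove (Set.range fun x : {x : EuclideanSpace ℝ (Fin k) // ‖x‖ ≤ 1} =>
      ‖T x.1‖) := by
    refine ⟨‖T.toContinuousLinearMap‖, ?_⟩
    rintro _ ⟨x, rfl⟩
    have := T.toContinuousLinearMap.le_opNorm x.1
    refine le_trans this ?_
    exact mul_le_of_le_one_right (norm_nonneg _) x.2
  have h1 : ∀ x : EuclideanSpace ℝ (Fin k), ‖T x‖ ≤ specNorm H * ‖x‖ := by
    intro x
    by_cases hx : x = 0
    · simp [hx]
    have hxn : 0 < ‖x‖ := norm_pos_iff.2 hx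
    have h2 : ‖T (‖x‖⁻¹ • x)‖ ≤ specNorm H :=
      le_ciSup hbdd ⟨‖x‖⁻¹ • x, by simp [norm_smul, hxn.ne']⟩
    rw [map_smul, norm_smul, norm_inv, norm_norm, inv_mul_le_iff₀ hxn] at h2
    linarith
  have h3 : y ⬝ᵥ (H *ᵥ y) = inner ℝ (WithLp.toLp 2 y) (T (WithLp.toLp 2 y)) := by
    rw [EuclideanSpace.inner_eq_star_dotProduct]
    simp [hT, dotProduct_comm]
  have h4 : y ⬝ᵥ y = ‖WithLp.toLp 2 y‖ ^ 2 := by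
    rw [EuclideanSpace.real_norm_sq_eq]
    simp [dotProduct, pow_two]
  rw [h3, h4]
  refine (real_inner_le_norm _ _).trans ?_
  nlinarith [h1 (WithLp.toLp 2 y), norm_nonneg (WithLp.toLp 2 y)]

theorem square_identity {d k : ℕ} (A E : Matrix (Fin d) (Fin d) ℝ) (B : Matrix (Fin d) (Fin k) ℝ)
    (R : Matrix (Fin k) (Fin k) ℝ) (K D : Matrix (Fin k) (Fin d) ℝ) (hE : Eᵀ = E) (hR : Rᵀ = R) :
    (K - D)ᵀ * R * (K - D) + (A - B * (K - D))ᵀ * E * (A - B * (K - D))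
      = Kᵀ * R * K + (A - B * K)ᵀ * E * (A - B * K)
        - Dᵀ * ((R + Bᵀ * E * B) * K - Bᵀ * E * A)
        - ((R + Bᵀ * E * B) * K - Bᵀ * E * A)ᵀ * D + Dᵀ * (R + Bᵀ * E * B) * D := by
  simp only [Matrix.transpose_sub, Matrix.transpose_add, Matrix.transpose_mul, hE, hR,
    Matrix.transpose_transpose, Matrix.mul_sub, Matrix.sub_mul, Matrix.mul_add, Matrix.add_mul,
    Matrix.mul_assoc]
  abel

/-- feasibility of the natural policy gradient step. -/
theorem natural_pg_step_feasibility
    (d k N : ℕ) (hd : 0 < d) (hk : 0 < k) (hN : 0 < N)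
    (A : Fin N → Matrix (Fin d) (Fin d) ℝ) (B : Fin N → Matrix (Fin d) (Fin k) ℝ)
    (Pr : Matrix (Fin N) (Fin N) ℝ)
    (hPr : ∀ i j, 0 ≤ Pr i j) (hPrSum : ∀ i, ∑ j, Pr i j = 1)
    (piv : Fin N → ℝ) (hpiv : ∀ i, 0 < piv i) (hpivSum : ∑ i, piv i = 1)
    (Sg : Matrix (Fin d) (Fin d) ℝ) (hSg : Sg.PosDef)
    (Q : Fin N → Matrix (Fin d) (Fin d) ℝ) (hQ : ∀ i, (Q i).PosDef)
    (R : Fin N → Matrix (Fin k) (Fin k) ℝ) (hR : ∀ i, (R i).PosDef)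
    (K : Fin N → Matrix (Fin k) (Fin d) ℝ) (hK : MSS Pr A B K)
    (η : ℝ) (hη0 : 0 < η)
    (hη : η ≤ 1 / (2 * ⨆ i, specNorm (R i + (B i)ᵀ * opE Pr (PK Pr A B Q R K) i * B i))) :
    MSS Pr A B (K - (2 * η) • LK Pr A B Q R K) := by
  have hpow := fun v => pow_mulVec_tendsto (calA Pr (Gam A B K)) hK v
  have hRs : ∀ i, (R i)ᵀ = R i := fun i => by
    simpa [Matrix.IsHermitian, Matrix.conjTranspose_eq_transpose_of_trivial] using (hR i).1
  have hQs : ∀ i, (Q i)ᵀ = Q i := fun i => by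
    simpa [Matrix.IsHermitian, Matrix.conjTranspose_eq_transpose_of_trivial] using (hQ i).1
  have hP : IsLyap Pr A B Q R K (PK Pr A B Q R K) := by
    have hex : ∃ P, IsLyap Pr A B Q R K P :=
      lyap_exists Pr (Gam A B K) hpow (fun i => Q i + (K i)ᵀ * R i * K i)
    rw [PK, dif_pos hex]
    exact hex.choose_spec
  unfold LK
  generalize PK Pr A B Q R K = P at hP hη ⊢
  have hPs : ∀ i, (P i)ᵀ = P i :=
    lyap_symm Pr (Gam A B K) hpow (fun i => Q i + (K i)ᵀ * R i * K i) P
      (fun i => by simp [Matrix.transpose_mul, hRs, hQs, Matrix.mul_assoc]) hP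
  have hEs : ∀ i, (opE Pr P i)ᵀ = opE Pr P i := fun i => by
    simp [opE, Matrix.transpose_sum, hPs]
  have hQn : ∀ i x, 0 ≤ x ⬝ᵥ (Q i *ᵥ x) := fun i x => by
    simpa using (hQ i).posSemidef.dotProduct_mulVec_nonneg x
  have hRn : ∀ i x, 0 ≤ x ⬝ᵥ (R i *ᵥ x) := fun i x => by
    simpa using (hR i).posSemidef.dotProduct_mulVec_nonneg x
  have hconj : ∀ {a b : ℕ} (M : Matrix (Fin a) (Fin a) ℝ) (L : Matrix (Fin a) (Fin b) ℝ)
      (x : Fin b → ℝ), x ⬝ᵥ ((Lᵀ * M * L) *ᵥ x) = (L *ᵥ x) ⬝ᵥ (M *ᵥ (L *ᵥ x)) := by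
    intro a b M L x
    rw [← Matrix.mulVec_mulVec, ← Matrix.mulVec_mulVec,
      Matrix.dotProduct_mulVec x, Matrix.vecMul_transpose]
  have hPq : ∀ i x, x ⬝ᵥ (P i *ᵥ x) = x ⬝ᵥ (Q i *ᵥ x) + (K i *ᵥ x) ⬝ᵥ (R i *ᵥ (K i *ᵥ x))
      + x ⬝ᵥ (opL Pr (Gam A B K) P i *ᵥ x) := by
    intro i x
    conv_lhs => rw [hP i]
    rw [Matrix.add_mulVec, Matrix.add_mulVec, dotProduct_add, dotProduct_add, hconj]
    rfl
  have hPn : ∀ i x, 0 ≤ x ⬝ᵥ (P i *ᵥ x) :=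
    lyap_nonneg Pr hPr (Gam A B K) hpow P (fun i x => by
      rw [hPq i x]
      linarith [hQn i x, hRn i (K i *ᵥ x)])
  have hPQ : ∀ i x, x ⬝ᵥ (Q i *ᵥ x) ≤ x ⬝ᵥ (P i *ᵥ x) := by
    intro i x
    rw [hPq i x, quad_opL]
    have : 0 ≤ ∑ j, Pr i j * ((Gam A B K i *ᵥ x) ⬝ᵥ (P j *ᵥ (Gam A B K i *ᵥ x))) :=
      Finset.sum_nonneg fun j _ => mul_nonneg (hPr i j) (hPn _ _)
    linarith [hRn i (K i *ᵥ x)]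
  set s := ⨆ i, specNorm (R i + (B i)ᵀ * opE Pr P i * B i) with hs
  have hspos : 0 < s := by
    by_contra hcon
    push Not at hcon
    have : 1 / (2 * s) ≤ 0 := one_div_nonpos.2 (by linarith)
    linarith
  have hηs : 2 * η * s ≤ 1 := by
    rw [le_div_iff₀ (by positivity)] at hη
    linarith
  have hsi : ∀ i, specNorm (R i + (B i)ᵀ * opE Pr P i * B i) ≤ s := fun i =>
    le_ciSup (f := fun i => specNorm (R i + (B i)ᵀ * opE Pr P i * B i))
      (Set.finite_range _).bddAbove i
  set Knew := K - (2 * η) • (fun i => (R i + (B i)ᵀ * opE Pr P i * B i) * K i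
    - (B i)ᵀ * opE Pr P i * A i) with hKnew
  have hdec : ∀ i x, x ⬝ᵥ (opL Pr (Gam A B Knew) P i *ᵥ x)
      ≤ x ⬝ᵥ (P i *ᵥ x) - x ⬝ᵥ (Q i *ᵥ x) := by
    intro i x
    set H := R i + (B i)ᵀ * opE Pr P i * B i with hH
    set L := H * K i - (B i)ᵀ * opE Pr P i * A i with hL
    have hKnewi : Knew i = K i - (2 * η) • L := rfl
    have hid := square_identity (A i) (opE Pr P i) (B i) (R i) (K i) ((2 * η) • L) (hEs i) (hRs i)
    rw [← hKnewi, ← hH, ← hL] at hid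
    have hid2 : (Knew i)ᵀ * R i * Knew i + opL Pr (Gam A B Knew) P i
        = (P i - Q i) - (2 * η) • (Lᵀ * (1 : Matrix (Fin k) (Fin k) ℝ) * L) - (2 * η) • (Lᵀ * (1 : Matrix (Fin k) (Fin k) ℝ) * L)
          + ((2 * η) * (2 * η)) • (Lᵀ * H * L) := by
      have hPi : P i - Q i = (K i)ᵀ * R i * K i
          + (A i - B i * K i)ᵀ * opE Pr P i * (A i - B i * K i) := by
        have := hP i
        unfold Gam at this
        rw [sub_eq_iff_eq_add]
        conv_lhs => rw [this]
        abel
      rw [hPi]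
      refine Eq.trans hid ?_
      simp [Matrix.transpose_smul, smul_smul]
    have hq := congrArg (fun M => x ⬝ᵥ (M *ᵥ x)) hid2
    simp only [Matrix.add_mulVec, Matrix.sub_mulVec, Matrix.smul_mulVec, dotProduct_add,
      dotProduct_sub, dotProduct_smul, hconj, Matrix.one_mulVec, smul_eq_mul] at hq
    have hw0 : 0 ≤ (L *ᵥ x) ⬝ᵥ (L *ᵥ x) := by
      simpa using dotProduct_star_self_nonneg (L *ᵥ x)
    have hHw : (L *ᵥ x) ⬝ᵥ (H *ᵥ (L *ᵥ x)) ≤ s * ((L *ᵥ x) ⬝ᵥ (L *ᵥ x)) :=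
      (specNorm_quad H _).trans (mul_le_mul_of_nonneg_right (hsi i) hw0)
    have hRk := hRn i (Knew i *ᵥ x)
    generalize (L *ᵥ x) ⬝ᵥ (L *ᵥ x) = w at *
    generalize (L *ᵥ x) ⬝ᵥ (H *ᵥ (L *ᵥ x)) = h at *
    have h1 : 2 * η * (2 * η) * h ≤ 2 * η * (2 * η) * (s * w) :=
      mul_le_mul_of_nonneg_left hHw (by positivity)
    have h2 : 2 * η * s * (2 * η * w) ≤ 1 * (2 * η * w) :=
      mul_le_mul_of_nonneg_right hηs (by positivity)
    have h3 : 0 ≤ 2 * η * w := by positivity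
    nlinarith
  have : Nonempty (Fin N) := ⟨⟨0, hN⟩⟩
  have : Nonempty (Fin d) := ⟨⟨0, hd⟩⟩
  choose e1 he1 hb1 using fun i => posdef_bound hd (Q i) 1 (hQ i)
  choose e2 he2 hb2 using fun i => posdef_bound hd (Q i) (P i) (hQ i)
  obtain ⟨i1, hi1⟩ := Finite.exists_min e1
  obtain ⟨i2, hi2⟩ := Finite.exists_min e2
  set δ := min (e2 i2) (1 / 2) with hδ
  have hδ0 : 0 < δ := lt_min (he2 _) (by norm_num)
  have hδ1 : δ ≤ 1 / 2 := min_le_right _ _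
  refine sr_lt_one_aux _ fun l hl v hv => ?_
  refine stab Pr hPr (Gam A B Knew) (fun i x => x ⬝ᵥ (P i *ᵥ x)) (1 - δ) (e1 i1) (by linarith)
    (by linarith) (he1 _) ?_ ?_ l hl v hv
  · intro i x
    rw [← quad_opL]
    refine (hdec i x).trans ?_
    have h1 : δ * (x ⬝ᵥ (P i *ᵥ x)) ≤ e2 i * (x ⬝ᵥ (P i *ᵥ x)) :=
      mul_le_mul_of_nonneg_right ((min_le_left _ _).trans (hi2 i)) (hPn i x)
    have h2 := hb2 i x
    linarith
  · intro i x
    have hx0 : 0 ≤ x ⬝ᵥ x := by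
      simpa using dotProduct_star_self_nonneg x
    have h1 : e1 i1 * (x ⬝ᵥ x) ≤ e1 i * (x ⬝ᵥ x) := mul_le_mul_of_nonneg_right (hi1 i) hx0
    have h2 := hb1 i x
    rw [Matrix.one_mulVec] at h2
    exact h1.trans (h2.trans (hPQ i x))

end MJLS
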